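/- Let A : ℝ → ℝ be a Lipschitz function with Lipschitz constant ‖A‖_Lip, and let C_A be the Calderón commutator. Then for every bounded interval I = [a,b], the principal value defining C_A(χ_I)(x) exists for a.e. x, and ∫_I |C_A χ_I(x)|² dx ≤ C ‖A‖_Lip² |I| for an absolute constant C. In fact, for every x ∉ {a,b} one has the identity C_A(χ_{[a,b]})(x) = (A(x)−A(b))/(x−b) − (A(x)−A(a))/(x−a) + H(A′χ_{(a,b)})(x). -/

import Mathlib

open MeasureTheory Set ENNReal Filter

noncomputable section

/-- The `ε`-truncation of the Calderón commutator
`C_A f(x) = p.v.∫ f(y)·(A(x)−A(y))/(x−y)² dy`. -/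
def commTrunc (A : ℝ → ℝ) (f : ℝ → ℝ) (ε : ℝ) (x : ℝ) : ℝ :=
  ∫ y in {y : ℝ | ε < |x - y|}, f y * (A x - A y) / (x - y) ^ 2

/-- The `ε`-truncation of the Hilbert transform `Hf(x) = p.v.∫ f(y)/(x−y) dy`. -/
def hilbertTrunc (f : ℝ → ℝ) (ε : ℝ) (x : ℝ) : ℝ :=
  ∫ y in {y : ℝ | ε < |x - y|}, f y / (x - y)

theorem integral_commutator_kernel_eq {A : ℝ → ℝ} {K : NNReal} (hA : LipschitzWith K A)
    {x p q : ℝ} (hpq : p ≤ q) (hx : x ∉ Icc p q) :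
    ∫ y in p..q, (A x - A y) / (x - y) ^ 2 =
      (A x - A q) / (x - q) - (A x - A p) / (x - p) + ∫ y in p..q, deriv A y / (x - y) := by
  have hne : ∀ y ∈ Icc p q, x - y ≠ 0 := by
    intro y hy h
    exact hx (by rwa [sub_eq_zero.1 h])
  have hf : AbsolutelyContinuousOnInterval (fun y => A x - A y) p q :=
    ((LipschitzWith.const (A x)).sub hA).lipschitzOnWith.absolutelyContinuousOnInterval
  have hg : AbsolutelyContinuousOnInterval (fun y => (x - y)⁻¹) p q := by
    refine ContDiffOn.absolutelyContinuousOnInterval ?_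
    rw [uIcc_of_le hpq]
    exact (contDiffOn_const.sub contDiffOn_id).inv hne
  have hd : ∀ y ∈ Icc p q, deriv (fun y => (x - y)⁻¹) y = ((x - y) ^ 2)⁻¹ := by
    intro y hy
    have h := (((hasDerivAt_id y).const_sub x).inv (hne y hy)).deriv
    refine Eq.trans h ?_
    simp
  have key := hf.integral_mul_deriv_eq_deriv_mul hg
  have e1 : ∫ y in p..q, (A x - A y) / (x - y) ^ 2 =
      ∫ y in p..q, (A x - A y) * deriv (fun y => (x - y)⁻¹) y := by
    refine intervalIntegral.integral_congr fun y hy => ?_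
    rw [uIcc_of_le hpq] at hy
    simp only [hd y hy, div_eq_mul_inv]
  have e2 : ∫ y in p..q, deriv (fun y => A x - A y) y * (x - y)⁻¹ =
      - ∫ y in p..q, deriv A y / (x - y) := by
    rw [← intervalIntegral.integral_neg]
    refine intervalIntegral.integral_congr fun y hy => ?_
    simp only [deriv_const_sub, div_eq_mul_inv, neg_mul]
  rw [e1, key, e2]
  simp only [div_eq_mul_inv]
  ring

theorem setOf_lt_abs_sub_inter_Ioc_eq_of_mem {a b x ε : ℝ} (hε : 0 < ε) (h1 : ε < x - a)
    (h2 : ε < b - x) :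
    (Ioc a b ∩ {y : ℝ | ε < |x - y|} : Set ℝ) =ᵐ[volume]
      (Ioc a (x - ε) ∪ Ioc (x + ε) b : Set ℝ) := by
  have : ∀ᵐ y : ℝ, y ≠ x - ε := by simp [ae_iff]
  filter_upwards [this] with y hy
  refine propext ?_
  change (y ∈ Ioc a b ∧ ε < |x - y|) ↔ (y ∈ Ioc a (x - ε) ∨ y ∈ Ioc (x + ε) b)
  simp only [mem_Ioc, lt_abs]
  constructor
  · rintro ⟨⟨ha, hb⟩, h | h⟩
    · left; constructor <;> linarith
    · right; constructor <;> linarith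
  · rintro (⟨ha, hb⟩ | ⟨ha, hb⟩)
    · have := lt_of_le_of_ne hb hy
      refine ⟨⟨ha, by linarith⟩, Or.inl (by linarith)⟩
    · exact ⟨⟨by linarith, hb⟩, Or.inr (by linarith)⟩

theorem setOf_lt_abs_sub_inter_Ioc_eq_of_notMem {a b x ε : ℝ}
    (h : ε < a - x ∨ ε < x - b) :
    Ioc a b ∩ {y : ℝ | ε < |x - y|} = Ioc a b := by
  refine inter_eq_left.2 fun y hy => ?_
  simp only [mem_Ioc, mem_ofPred_eq, lt_abs] at hy ⊢
  rcases h with h | h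
  · right; linarith
  · left; linarith

theorem setIntegral_setOf_lt_abs_sub_indicator {J : Set ℝ} {a b : ℝ} (hJ : J =ᵐ[volume] Ioc a b)
    (hJm : MeasurableSet J) (F : ℝ → ℝ) (ε x : ℝ) :
    ∫ y in {y : ℝ | ε < |x - y|}, J.indicator F y =
      ∫ y in Ioc a b ∩ {y : ℝ | ε < |x - y|}, F y := by
  rw [integral_indicator hJm, Measure.restrict_restrict hJm]
  exact setIntegral_congr_set (hJ.inter (ae_eq_refl _))

theorem commTrunc_indicator_Icc (A : ℝ → ℝ) (a b ε x : ℝ) :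
    commTrunc A ((Icc a b).indicator fun _ => (1 : ℝ)) ε x =
      ∫ y in Ioc a b ∩ {y : ℝ | ε < |x - y|}, (A x - A y) / (x - y) ^ 2 := by
  rw [← setIntegral_setOf_lt_abs_sub_indicator Ioc_ae_eq_Icc.symm measurableSet_Icc, commTrunc]
  congr 1
  ext y
  by_cases hy : y ∈ Icc a b <;> simp [hy]

theorem hilbertTrunc_indicator_Ioo (f : ℝ → ℝ) (a b ε x : ℝ) :
    hilbertTrunc ((Ioo a b).indicator f) ε x =
      ∫ y in Ioc a b ∩ {y : ℝ | ε < |x - y|}, f y / (x - y) := by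
  rw [← setIntegral_setOf_lt_abs_sub_indicator Ioo_ae_eq_Ioc measurableSet_Ioo, hilbertTrunc]
  congr 1
  ext y
  by_cases hy : y ∈ Ioo a b <;> simp [hy]

theorem hilbertTrunc_congr_ae {f g : ℝ → ℝ} (h : f =ᵐ[volume] g) (ε x : ℝ) :
    hilbertTrunc f ε x = hilbertTrunc g ε x := by
  refine integral_congr_ae (ae_restrict_of_ae ?_)
  filter_upwards [h] with y hy
  rw [hy]

theorem LipschitzWith.intervalIntegrable_deriv_div {A : ℝ → ℝ} {K : NNReal}
    (hA : LipschitzWith K A) {x p q : ℝ} (hpq : p ≤ q) (hx : x ∉ Icc p q) :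
    IntervalIntegrable (fun y => deriv A y / (x - y)) volume p q := by
  have hne : ∀ y ∈ uIcc p q, x - y ≠ 0 := by
    intro y hy h
    rw [uIcc_of_le hpq] at hy
    exact hx (by rwa [sub_eq_zero.1 h])
  simp only [div_eq_mul_inv]
  refine IntervalIntegrable.mul_continuousOn ?_ ((continuousOn_const.sub continuousOn_id).inv₀ hne)
  exact hA.lipschitzOnWith.absolutelyContinuousOnInterval.intervalIntegrable_deriv

theorem LipschitzWith.intervalIntegrable_commutator_kernel {A : ℝ → ℝ} {K : NNReal}
    (hA : LipschitzWith K A) {x p q : ℝ} (hpq : p ≤ q) (hx : x ∉ Icc p q) :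
    IntervalIntegrable (fun y => (A x - A y) / (x - y) ^ 2) volume p q := by
  refine ContinuousOn.intervalIntegrable ?_
  refine (continuousOn_const.sub hA.continuous.continuousOn).div (by fun_prop) fun y hy h => ?_
  rw [uIcc_of_le hpq] at hy
  exact hx (by rwa [sub_eq_zero.1 (pow_eq_zero_iff two_ne_zero |>.1 h)])

theorem setIntegral_Ioc_inter_setOf_lt_abs_sub {F : ℝ → ℝ} {a b x ε : ℝ} (hε : 0 < ε)
    (h1 : ε < x - a) (h2 : ε < b - x) (hF1 : IntervalIntegrable F volume a (x - ε))
    (hF2 : IntervalIntegrable F volume (x + ε) b) :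
    ∫ y in Ioc a b ∩ {y : ℝ | ε < |x - y|}, F y =
      (∫ y in a..(x - ε), F y) + ∫ y in (x + ε)..b, F y := by
  rw [setIntegral_congr_set (setOf_lt_abs_sub_inter_Ioc_eq_of_mem hε h1 h2),
    setIntegral_union _ measurableSet_Ioc
      ((intervalIntegrable_iff_integrableOn_Ioc_of_le (by linarith)).1 hF1)
      ((intervalIntegrable_iff_integrableOn_Ioc_of_le (by linarith)).1 hF2),
    intervalIntegral.integral_of_le (by linarith), intervalIntegral.integral_of_le (by linarith)]
  exact Set.disjoint_left.2 fun y hy hy' => by linarith [hy.2, hy'.1]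

theorem tendsto_commTrunc_indicator_Icc {A : ℝ → ℝ} {K : NNReal} (hA : LipschitzWith K A)
    {a b x c l : ℝ} (hab : a < b) (hxa : x ≠ a) (hxb : x ≠ b) (hd : HasDerivAt A c x)
    (hl : Tendsto (fun ε => hilbertTrunc ((Ioo a b).indicator (deriv A)) ε x)
      (nhdsWithin 0 (Ioi 0)) (nhds l)) :
    Tendsto (fun ε => commTrunc A ((Icc a b).indicator fun _ => (1 : ℝ)) ε x)
      (nhdsWithin 0 (Ioi 0))
      (nhds ((A x - A b) / (x - b) - (A x - A a) / (x - a) + l)) := by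
  by_cases hx : x ∈ Icc a b
  · have ha : a < x := lt_of_le_of_ne hx.1 (Ne.symm hxa)
    have hb : x < b := lt_of_le_of_ne hx.2 hxb
    have hslope := hasDerivAt_iff_tendsto_slope.1 hd
    have hshift : ∀ σ : ℝ, σ ≠ 0 → Tendsto (fun ε : ℝ => x + σ * ε) (nhdsWithin 0 (Ioi 0))
        (nhdsWithin x {x}ᶜ) := by
      intro σ hσ
      refine tendsto_nhdsWithin_iff.2 ⟨?_, ?_⟩
      · have : Tendsto (fun ε : ℝ => x + σ * ε) (nhds 0) (nhds (x + σ * 0)) :=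
          Continuous.tendsto (by fun_prop) 0
        simp only [mul_zero, add_zero] at this
        exact this.mono_left nhdsWithin_le_nhds
      · filter_upwards [self_mem_nhdsWithin] with ε hε
        simp [hσ, (ne_of_gt hε : ε ≠ 0)]
    have h1 := hslope.comp (hshift (-1) (by norm_num))
    have h2 := hslope.comp (hshift 1 (by norm_num))
    have hlim := (((h1.sub h2).const_add ((A x - A b) / (x - b) - (A x - A a) / (x - a)))).add hl
    rw [sub_self, add_zero] at hlim
    refine hlim.congr' ?_
    have hs1 : Ioo (0 : ℝ) (min (x - a) (b - x)) ∈ nhdsWithin (0 : ℝ) (Ioi 0) :=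
      Ioo_mem_nhdsGT (lt_min (by linarith) (by linarith))
    filter_upwards [hs1] with ε hε
    have hε0 : 0 < ε := hε.1
    have hε1 : ε < x - a := hε.2.trans_le (min_le_left _ _)
    have hε2 : ε < b - x := hε.2.trans_le (min_le_right _ _)
    have n1 : x ∉ Icc a (x - ε) := fun h => by linarith [h.2]
    have n2 : x ∉ Icc (x + ε) b := fun h => by linarith [h.1]
    have l1 : a ≤ x - ε := by linarith
    have l2 : x + ε ≤ b := by linarith
    rw [commTrunc_indicator_Icc, hilbertTrunc_indicator_Ioo,
      setIntegral_Ioc_inter_setOf_lt_abs_sub hε0 hε1 hε2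
        (hA.intervalIntegrable_commutator_kernel l1 n1)
        (hA.intervalIntegrable_commutator_kernel l2 n2),
      setIntegral_Ioc_inter_setOf_lt_abs_sub hε0 hε1 hε2
        (hA.intervalIntegrable_deriv_div l1 n1) (hA.intervalIntegrable_deriv_div l2 n2),
      integral_commutator_kernel_eq hA l1 n1, integral_commutator_kernel_eq hA l2 n2]
    simp only [Function.comp_apply, slope_def_field, neg_mul, one_mul, ← sub_eq_add_neg]
    have e1 : (A (x - ε) - A x) / (x - ε - x) = (A x - A (x - ε)) / (x - (x - ε)) := by
      rw [← neg_div_neg_eq]; congr 1 <;> ring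
    have e2 : (A (x + ε) - A x) / (x + ε - x) = (A x - A (x + ε)) / (x - (x + ε)) := by
      rw [← neg_div_neg_eq]; congr 1 <;> ring
    rw [e1, e2]
    ring
  · have hpos : 0 < max (a - x) (x - b) := by
      simp only [mem_Icc, not_and_or, not_le] at hx
      rcases hx with h | h
      · exact lt_max_of_lt_left (by linarith)
      · exact lt_max_of_lt_right (by linarith)
    refine (hl.const_add ((A x - A b) / (x - b) - (A x - A a) / (x - a))).congr' ?_
    filter_upwards [Ioo_mem_nhdsGT hpos] with ε hε
    rw [commTrunc_indicator_Icc, hilbertTrunc_indicator_Ioo,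
      setOf_lt_abs_sub_inter_Ioc_eq_of_notMem (lt_max_iff.1 hε.2),
      ← intervalIntegral.integral_of_le hab.le, ← intervalIntegral.integral_of_le hab.le,
      integral_commutator_kernel_eq hA hab.le hx]

theorem integral_comp_sub_mul (ψ : ℝ → ℝ) (x : ℝ) {s : ℝ} (hs : 0 < s) :
    ∫ u, ψ (x - s * u) = s⁻¹ * ∫ t, ψ t := by
  rw [Measure.integral_comp_mul_left (fun v => ψ (x - v)) s, integral_sub_left_eq_self ψ volume x,
    abs_of_pos (inv_pos.2 hs), smul_eq_mul]

theorem ae_tendsto_average_abs_sub {f : ℝ → ℝ} (hf : LocallyIntegrable f) :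
    ∀ᵐ x : ℝ, Tendsto (fun r => ⨍ y in Metric.closedBall x r, |f y - f x|)
      (nhdsWithin 0 (Ioi 0)) (nhds 0) := by
  filter_upwards [IsUnifLocDoublingMeasure.ae_tendsto_average_norm_sub volume hf 1] with x hx
  refine hx (fun _ => x) id tendsto_id ?_
  filter_upwards [self_mem_nhdsWithin] with r hr
  exact Metric.mem_closedBall_self (by simpa using (le_of_lt hr : (0 : ℝ) ≤ r))

theorem tendsto_setIntegral_closedBall_abs_sub {f : ℝ → ℝ} {x : ℝ}
    (hx : Tendsto (fun r => ⨍ y in Metric.closedBall x r, |f y - f x|)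
      (nhdsWithin 0 (Ioi 0)) (nhds 0)) {R : ℝ} (hR : 0 < R) :
    Tendsto (fun s => ∫ u in Metric.closedBall 0 R, |f (x - s * u) - f x|)
      (nhdsWithin 0 (Ioi 0)) (nhds 0) := by
  have hsc : Tendsto (fun s : ℝ => R * s) (nhdsWithin 0 (Ioi 0)) (nhdsWithin 0 (Ioi 0)) := by
    refine tendsto_nhdsWithin_iff.2 ⟨?_, ?_⟩
    · have : Tendsto (fun s : ℝ => R * s) (nhds 0) (nhds (R * 0)) :=
        Continuous.tendsto (by fun_prop) 0
      rw [mul_zero] at this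
      exact this.mono_left nhdsWithin_le_nhds
    · filter_upwards [self_mem_nhdsWithin] with s hs using mul_pos hR hs
  have h := (hx.comp hsc).const_mul (2 * R)
  rw [mul_zero] at h
  refine h.congr' ?_
  filter_upwards [self_mem_nhdsWithin] with s (hs : 0 < s)
  have e : ∀ u, (Metric.closedBall (0 : ℝ) R).indicator (fun u => |f (x - s * u) - f x|) u =
      (Metric.closedBall x (R * s)).indicator (fun t => |f t - f x|) (x - s * u) := by
    intro u
    have : u ∈ Metric.closedBall (0 : ℝ) R ↔ x - s * u ∈ Metric.closedBall x (R * s) := by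
      simp only [Metric.mem_closedBall, Real.dist_eq, sub_zero, sub_sub_cancel_left, abs_neg,
        abs_mul, abs_of_pos hs]
      rw [mul_comm R s, mul_le_mul_iff_right₀ hs]
    by_cases hu : u ∈ Metric.closedBall (0 : ℝ) R
    · rw [indicator_of_mem hu, indicator_of_mem (this.1 hu)]
    · rw [indicator_of_notMem hu, indicator_of_notMem (fun h => hu (this.2 h))]
  rw [← integral_indicator Metric.isClosed_closedBall.measurableSet]
  simp_rw [e]
  rw [integral_comp_sub_mul _ x hs, integral_indicator Metric.isClosed_closedBall.measurableSet,
    Function.comp_apply, setAverage_eq, Real.volume_real_closedBall (by positivity), smul_eq_mul]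
  field_simp

theorem tendsto_integral_comp_sub_mul {f : ℝ → ℝ} (hf : Measurable f) {M : ℝ}
    (hM : ∀ x, |f x| ≤ M) {x : ℝ}
    (hx : Tendsto (fun r => ⨍ y in Metric.closedBall x r, |f y - f x|)
      (nhdsWithin 0 (Ioi 0)) (nhds 0)) {D : ℝ → ℝ} (hDm : Measurable D) (hD : Integrable D) :
    Tendsto (fun s => ∫ u, f (x - s * u) * D u) (nhdsWithin 0 (Ioi 0))
      (nhds (f x * ∫ u, D u)) := by
  have hM0 : 0 ≤ M := (abs_nonneg _).trans (hM 0)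
  set T : ℕ → Set ℝ := fun n => {u | |D u| ≤ n ∧ |u| ≤ n} with hT
  have hTm : ∀ n, MeasurableSet (T n) := fun n =>
    (measurableSet_le hDm.abs measurable_const).inter
      (measurableSet_le measurable_id.abs measurable_const)
  have htail : Tendsto (fun n => ∫ u, (T n)ᶜ.indicator (fun u => |D u|) u) atTop (nhds 0) := by
    have := tendsto_integral_of_dominated_convergence (μ := volume)
      (F := fun n u => (T n)ᶜ.indicator (fun u => |D u|) u) (f := fun _ => (0 : ℝ))
      (fun u => |D u|)
      (fun n => (hDm.abs.indicator (hTm n).compl).aestronglyMeasurable) hD.abs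
      (fun n => Eventually.of_forall fun u => ?_) (Eventually.of_forall fun u => ?_)
    · simpa using this
    · by_cases hu : u ∈ (T n)ᶜ <;> simp [hu]
    · obtain ⟨N, hN⟩ := exists_nat_ge (max |D u| |u|)
      refine tendsto_const_nhds.congr' ?_
      filter_upwards [eventually_ge_atTop N] with n hn
      have hn' : (N : ℝ) ≤ n := by exact_mod_cast hn
      rw [indicator_of_notMem]
      simp only [mem_compl_iff, not_not]
      exact ⟨(le_max_left _ _).trans (hN.trans hn'), (le_max_right _ _).trans (hN.trans hn')⟩
  have hbd : ∀ y, |f y - f x| ≤ 2 * M := fun y => by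
    have h1 := abs_le.1 (hM y)
    have h2 := abs_le.1 (hM x)
    rw [abs_le]; constructor <;> linarith
  have h_integral : ∀ s, Integrable fun u => f (x - s * u) * D u := fun s =>
    hD.bdd_mul (c := M) (hf.comp (by fun_prop)).aestronglyMeasurable
      (Eventually.of_forall fun u => hM _)
  have hmeas : ∀ s, Measurable fun u => |f (x - s * u) - f x| := fun s =>
    ((hf.comp (by fun_prop : Measurable fun u : ℝ => x - s * u)).sub_const _).abs
  have hball : ∀ s R, IntegrableOn (fun u => |f (x - s * u) - f x|) (Metric.closedBall 0 R) := by
    intro s R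
    refine Measure.integrableOn_of_bounded (M := 2 * M) ?_ (hmeas s).aestronglyMeasurable
      (Eventually.of_forall fun u => ?_)
    · exact measure_closedBall_lt_top.ne
    · rw [Real.norm_eq_abs, abs_abs]; exact hbd _
  have key : ∀ (s : ℝ) (n : ℕ), |(∫ u, f (x - s * u) * D u) - f x * ∫ u, D u| ≤
      2 * M * (∫ u, (T n)ᶜ.indicator (fun u => |D u|) u) +
        n * ∫ u in Metric.closedBall 0 (n : ℝ), |f (x - s * u) - f x| := by
    intro s n
    rw [← integral_const_mul, ← integral_sub (h_integral s) (hD.const_mul _),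
      ← integral_indicator Metric.isClosed_closedBall.measurableSet, ← integral_const_mul,
      ← integral_const_mul, ← integral_add, ← Real.norm_eq_abs]
    · refine (norm_integral_le_integral_norm _).trans (integral_mono ?_ ?_ fun u => ?_)
      · exact ((h_integral s).sub (hD.const_mul _)).norm
      · exact ((hD.abs.indicator (hTm n).compl).const_mul _).add
          (((hball s n).integrable_indicator Metric.isClosed_closedBall.measurableSet).const_mul _)
      · simp only [Real.norm_eq_abs, ← sub_mul, abs_mul]
        by_cases hu : u ∈ T n
        · have hu' : u ∈ Metric.closedBall (0 : ℝ) n := by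
            simpa [Metric.mem_closedBall] using hu.2
          rw [indicator_of_notMem (by simpa using hu), indicator_of_mem hu', mul_zero, zero_add,
            mul_comm]
          exact mul_le_mul_of_nonneg_right hu.1 (abs_nonneg _)
        · rw [indicator_of_mem (by simpa using hu)]
          refine le_add_of_le_of_nonneg (mul_le_mul_of_nonneg_right (hbd _) (abs_nonneg _)) ?_
          exact mul_nonneg n.cast_nonneg (indicator_nonneg (fun _ _ => abs_nonneg _) _)
    · exact (hD.abs.indicator (hTm n).compl).const_mul _
    · exact ((hball s n).integrable_indicator Metric.isClosed_closedBall.measurableSet).const_mul _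
  rw [Metric.tendsto_nhds]
  intro δ hδ
  have h1 := htail.const_mul (2 * M)
  rw [mul_zero] at h1
  obtain ⟨n, hn, hn0⟩ := ((h1.eventually (gt_mem_nhds (half_pos hδ))).and
    (eventually_gt_atTop 0)).exists
  have h2 := (tendsto_setIntegral_closedBall_abs_sub hx
    (R := (n : ℝ)) (by exact_mod_cast hn0)).const_mul (n : ℝ)
  rw [mul_zero] at h2
  filter_upwards [h2.eventually (gt_mem_nhds (half_pos hδ))] with s hs
  rw [Real.dist_eq]
  linarith [key s n]

/-- The kernel `χ_{|u| > 1} / u` of the Hilbert transform truncated at scale one. -/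
def truncKernel (u : ℝ) : ℝ := {u : ℝ | 1 < |u|}.indicator (fun u => u⁻¹) u

/-- The conjugate Poisson kernel at scale one. -/
def conjPoissonKernel (u : ℝ) : ℝ := u / (u ^ 2 + 1)

/-- The Hilbert transform of `χ_{[-1,1]} / 2`. -/
def logKernel (u : ℝ) : ℝ := (Real.log (u + 1) - Real.log (u - 1)) / 2

/-- The logarithmic potential of `f`, whose derivative is the Hilbert transform of `f`. -/
def logPotential (f : ℝ → ℝ) (x : ℝ) : ℝ := ∫ t, f t * Real.log (x - t)

theorem measurable_truncKernel : Measurable truncKernel :=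
  measurable_inv.indicator (measurableSet_lt measurable_const measurable_id.abs)

theorem abs_truncKernel_le (u : ℝ) : |truncKernel u| ≤ 1 := by
  unfold truncKernel
  by_cases hu : u ∈ {u : ℝ | 1 < |u|}
  · rw [indicator_of_mem hu, abs_inv]
    exact inv_le_one_of_one_le₀ (le_of_lt hu)
  · rw [indicator_of_notMem hu]; simp

theorem truncKernel_neg (u : ℝ) : truncKernel (-u) = -truncKernel u := by
  unfold truncKernel
  by_cases hu : 1 < |u| <;> simp [hu, inv_neg]

theorem measurable_conjPoissonKernel : Measurable conjPoissonKernel := by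
  unfold conjPoissonKernel
  fun_prop

theorem conjPoissonKernel_neg (u : ℝ) : conjPoissonKernel (-u) = -conjPoissonKernel u := by
  simp [conjPoissonKernel, neg_div]

theorem measurable_logKernel : Measurable logKernel := by
  unfold logKernel
  fun_prop

theorem logKernel_neg (u : ℝ) : logKernel (-u) = -logKernel u := by
  unfold logKernel
  have h1 : -u + 1 = -(u - 1) := by ring
  have h2 : -u - 1 = -(u + 1) := by ring
  rw [h1, h2, Real.log_neg_eq_log, Real.log_neg_eq_log]
  ring

theorem integral_eq_zero_of_odd {D : ℝ → ℝ} (h : ∀ u, D (-u) = -D u) : ∫ u, D u = 0 := by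
  have h1 := integral_neg_eq_self D volume
  simp_rw [h, integral_neg] at h1
  linarith

theorem integrable_conjPoissonKernel_sub_truncKernel :
    Integrable fun u => conjPoissonKernel u - truncKernel u := by
  refine integrable_inv_one_add_sq.mono'
    (measurable_conjPoissonKernel.sub measurable_truncKernel).aestronglyMeasurable
    (Eventually.of_forall fun u => ?_)
  have hp : 0 < 1 + u ^ 2 := by positivity
  rw [Real.norm_eq_abs, conjPoissonKernel, truncKernel]
  by_cases hu : u ∈ {u : ℝ | 1 < |u|}
  · rw [indicator_of_mem hu]
    have hu' : 1 < |u| := hu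
    have h0 : u ≠ 0 := by rintro rfl; simp at hu'; linarith
    have e : u / (u ^ 2 + 1) - u⁻¹ = -(u⁻¹ * (1 + u ^ 2)⁻¹) := by
      field_simp
      ring
    rw [e, abs_neg, abs_mul, abs_inv, abs_of_pos (inv_pos.2 hp)]
    exact mul_le_of_le_one_left (by positivity) (inv_le_one_of_one_le₀ hu'.le)
  · rw [indicator_of_notMem hu, sub_zero, abs_div, add_comm (u ^ 2), abs_of_pos hp, div_eq_mul_inv]
    exact mul_le_of_le_one_left (by positivity) (not_lt.1 hu)

theorem abs_logKernel_sub_inv_le {u : ℝ} (hu : 2 ≤ u) :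
    |logKernel u - u⁻¹| ≤ 4 * (1 + u ^ 2)⁻¹ := by
  have hp : 0 < u + 1 := by linarith
  have hm : 0 < u - 1 := by linarith
  have h0 : 0 < u := by linarith
  have e1 : Real.log (u + 1) - Real.log (u - 1) ≤ 2 / (u - 1) := by
    rw [← Real.log_div hp.ne' hm.ne']
    refine (Real.log_le_sub_one_of_pos (div_pos hp hm)).trans_eq ?_
    field_simp; ring
  have e2 : 2 / (u + 1) ≤ Real.log (u + 1) - Real.log (u - 1) := by
    have := Real.log_le_sub_one_of_pos (div_pos hm hp)
    rw [Real.log_div hm.ne' hp.ne'] at this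
    have e : (u - 1) / (u + 1) - 1 = -(2 / (u + 1)) := by field_simp; ring
    linarith
  have b1 : 1 / (u - 1) - u⁻¹ ≤ 4 * (1 + u ^ 2)⁻¹ := by
    have : 1 / (u - 1) - u⁻¹ = 1 / (u * (u - 1)) := by field_simp; ring
    rw [this, ← div_eq_mul_inv, div_le_div_iff₀ (by positivity) (by positivity)]
    nlinarith
  have b2 : u⁻¹ - 1 / (u + 1) ≤ 4 * (1 + u ^ 2)⁻¹ := by
    have : u⁻¹ - 1 / (u + 1) = 1 / (u * (u + 1)) := by field_simp; ring
    rw [this, ← div_eq_mul_inv, div_le_div_iff₀ (by positivity) (by positivity)]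
    nlinarith
  have d1 : 2 / (u - 1) = 2 * (1 / (u - 1)) := by ring
  have d2 : 2 / (u + 1) = 2 * (1 / (u + 1)) := by ring
  rw [d1] at e1
  rw [d2] at e2
  rw [logKernel, abs_le]
  constructor <;> linarith

theorem integrableOn_log_add (c p q : ℝ) : IntegrableOn (fun u => Real.log (u + c)) (Icc p q) := by
  rcases le_or_gt p q with h | h
  · rw [integrableOn_Icc_iff_integrableOn_Ioc, ← intervalIntegrable_iff_integrableOn_Ioc_of_le h]
    have := (intervalIntegral.intervalIntegrable_log' (a := p + c) (b := q + c)).comp_add_right c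
    simpa using this
  · simp [Icc_eq_empty (not_le.2 h)]

theorem integrable_logKernel_sub_truncKernel :
    Integrable fun u => logKernel u - truncKernel u := by
  have hm := (measurable_logKernel.sub measurable_truncKernel).aestronglyMeasurable (μ := volume)
  have hlog : IntegrableOn logKernel (Icc (-2) 2) := by
    have := ((integrableOn_log_add 1 (-2) 2).sub (integrableOn_log_add (-1) (-2) 2)).div_const 2
    exact this
  have h1 : IntegrableOn (fun u => logKernel u - truncKernel u) (Icc (-2) 2) := by
    refine hlog.sub (Measure.integrableOn_of_bounded (M := 1) (by simp)
      measurable_truncKernel.aestronglyMeasurable (Eventually.of_forall fun u => ?_))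
    exact abs_truncKernel_le u
  have hb : ∀ u, 2 ≤ u → |logKernel u - truncKernel u| ≤ 4 * (1 + u ^ 2)⁻¹ := by
    intro u hu
    have : u ∈ {u : ℝ | 1 < |u|} := by
      change 1 < |u|
      rw [abs_of_nonneg (by linarith)]; linarith
    rw [truncKernel, indicator_of_mem this]
    exact abs_logKernel_sub_inv_le hu
  have h2 : IntegrableOn (fun u => logKernel u - truncKernel u) (Icc (-2) 2)ᶜ := by
    refine Integrable.mono' ((integrable_inv_one_add_sq.const_mul 4).restrict) hm.restrict ?_
    refine (ae_restrict_iff' measurableSet_Icc.compl).2 (Eventually.of_forall fun u hu => ?_)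
    rw [Real.norm_eq_abs]
    simp only [mem_compl_iff, mem_Icc, not_and_or, not_le] at hu
    rcases hu with hu | hu
    · have := hb (-u) (by linarith)
      rw [logKernel_neg, truncKernel_neg, neg_sub_neg, abs_sub_comm, neg_sq] at this
      exact this
    · exact hb u hu.le
  exact integrableOn_univ.1 (by simpa using h1.union h2)

theorem integral_comp_sub_mul_mul (f k : ℝ → ℝ) (x : ℝ) {s : ℝ} (hs : 0 < s) :
    ∫ u, f (x - s * u) * k u = s⁻¹ * ∫ t, f t * k ((x - t) / s) := by
  rw [← integral_comp_sub_mul (fun t => f t * k ((x - t) / s)) x hs]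
  refine integral_congr_ae (Eventually.of_forall fun u => ?_)
  simp only [_root_.sub_sub_cancel]
  rw [mul_div_cancel_left₀ _ hs.ne']

theorem hilbertTrunc_eq_integral_truncKernel (f : ℝ → ℝ) (x : ℝ) {s : ℝ} (hs : 0 < s) :
    hilbertTrunc f s x = ∫ u, f (x - s * u) * truncKernel u := by
  rw [integral_comp_sub_mul_mul f _ x hs, hilbertTrunc, ← integral_const_mul,
    ← integral_indicator (measurableSet_lt measurable_const (by fun_prop))]
  refine integral_congr_ae (Eventually.of_forall fun t => ?_)
  have hiff : (1 < |(x - t) / s|) ↔ s < |x - t| := by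
    rw [abs_div, abs_of_pos hs, lt_div_iff₀ hs, one_mul]
  by_cases ht : s < |x - t|
  · have h0 : x - t ≠ 0 := by intro h; rw [h] at ht; simp at ht; linarith
    simp only [truncKernel, indicator, mem_ofPred_eq, hiff, ht, if_true]
    field_simp
  · simp [truncKernel, indicator, hiff, ht]

theorem integral_conjPoisson_eq (f : ℝ → ℝ) (x : ℝ) {s : ℝ} (hs : 0 < s) :
    ∫ t, f t * ((x - t) / ((x - t) ^ 2 + s ^ 2)) = ∫ u, f (x - s * u) * conjPoissonKernel u := by
  rw [integral_comp_sub_mul_mul f _ x hs, ← integral_const_mul]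
  refine integral_congr_ae (Eventually.of_forall fun t => ?_)
  simp only [conjPoissonKernel]
  have : 0 < (x - t) ^ 2 + s ^ 2 := by positivity
  field_simp

theorem integrable_mul_of_eq_zero_off_Icc {f g : ℝ → ℝ} (hf : Measurable f) {M : ℝ}
    (hM : ∀ x, |f x| ≤ M) {a b : ℝ} (hsupp : ∀ x ∉ Icc a b, f x = 0)
    (hg : IntegrableOn g (Icc a b)) : Integrable fun t => f t * g t := by
  have h : IntegrableOn (fun t => f t * g t) (Icc a b) :=
    Integrable.bdd_mul (c := M) hg hf.aestronglyMeasurable (Eventually.of_forall hM)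
  refine (integrableOn_iff_integrable_of_support_subset fun t ht => ?_).1 h
  by_contra h'
  exact ht (by simp [hsupp t h'])

theorem integrable_mul_log_sub {f : ℝ → ℝ} (hf : Measurable f) {M : ℝ}
    (hM : ∀ x, |f x| ≤ M) {a b : ℝ} (hsupp : ∀ x ∉ Icc a b, f x = 0) (x : ℝ) :
    Integrable fun t => f t * Real.log (x - t) := by
  refine integrable_mul_of_eq_zero_off_Icc hf hM hsupp ?_
  refine (integrableOn_log_add (-x) a b).congr_fun (fun t _ => ?_) measurableSet_Icc
  simp only
  rw [← Real.log_neg_eq_log]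
  congr 1; ring

theorem logPotential_sub_div_eq {f : ℝ → ℝ} (hf : Measurable f) {M : ℝ}
    (hM : ∀ x, |f x| ≤ M) {a b : ℝ} (hsupp : ∀ x ∉ Icc a b, f x = 0) (x : ℝ) {s : ℝ}
    (hs : 0 < s) :
    (logPotential f (x + s) - logPotential f (x - s)) / (2 * s) =
      ∫ u, f (x - s * u) * logKernel u := by
  rw [integral_comp_sub_mul_mul f _ x hs, logPotential, logPotential,
    ← integral_sub (integrable_mul_log_sub hf hM hsupp _) (integrable_mul_log_sub hf hM hsupp _),
    div_eq_inv_mul, mul_inv, mul_comm (2 : ℝ)⁻¹, mul_assoc, ← integral_const_mul]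
  congr 1
  have h1 : ∀ᵐ t : ℝ, t ≠ x + s := by simp [ae_iff]
  have h2 : ∀ᵐ t : ℝ, t ≠ x - s := by simp [ae_iff]
  refine integral_congr_ae ?_
  filter_upwards [h1, h2] with t ht1 ht2
  have e1 : x + s - t = s * ((x - t) / s + 1) := by field_simp; ring
  have e2 : x - s - t = s * ((x - t) / s - 1) := by field_simp; ring
  have n1 : (x - t) / s + 1 ≠ 0 := fun h => by
    rw [h, mul_zero] at e1; exact ht1 (by linarith)
  have n2 : (x - t) / s - 1 ≠ 0 := fun h => by
    rw [h, mul_zero] at e2; exact ht2 (by linarith)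
  rw [e1, e2, Real.log_mul hs.ne' n1, Real.log_mul hs.ne' n2, logKernel]
  ring

theorem tendsto_integral_sub_hilbertTrunc {f : ℝ → ℝ} (hf : Measurable f) (hfi : Integrable f)
    {M : ℝ} (hM : ∀ x, |f x| ≤ M) {x : ℝ}
    (hx : Tendsto (fun r => ⨍ y in Metric.closedBall x r, |f y - f x|)
      (nhdsWithin 0 (Ioi 0)) (nhds 0)) {k : ℝ → ℝ} (hk : Measurable k)
    (hodd : ∀ u, k (-u) = -k u) (hki : Integrable fun u => k u - truncKernel u) :
    Tendsto (fun s => (∫ u, f (x - s * u) * k u) - hilbertTrunc f s x)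
      (nhdsWithin 0 (Ioi 0)) (nhds 0) := by
  have h := tendsto_integral_comp_sub_mul hf hM hx (D := fun u => k u - truncKernel u)
    (hk.sub measurable_truncKernel) hki
  rw [integral_eq_zero_of_odd (D := fun u => k u - truncKernel u), mul_zero] at h
  · refine h.congr' ?_
    filter_upwards [self_mem_nhdsWithin] with s (hs : 0 < s)
    have i1 : Integrable fun u => f (x - s * u) * truncKernel u :=
      ((hfi.comp_sub_left x).comp_mul_left' hs.ne').mul_bdd (c := 1)
        measurable_truncKernel.aestronglyMeasurable (Eventually.of_forall abs_truncKernel_le)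
    have i2 : Integrable fun u => f (x - s * u) * (k u - truncKernel u) :=
      hki.bdd_mul (c := M) (hf.comp (by fun_prop)).aestronglyMeasurable
        (Eventually.of_forall fun u => hM _)
    rw [hilbertTrunc_eq_integral_truncKernel f x hs, eq_sub_iff_add_eq, ← integral_add i2 i1]
    congr 1
    ext u
    ring
  · intro u
    rw [hodd, truncKernel_neg]; ring

theorem HasDerivAt.tendsto_symmetric_slope {G : ℝ → ℝ} {c x : ℝ} (h : HasDerivAt G c x) :
    Tendsto (fun s => (G (x + s) - G (x - s)) / (2 * s)) (nhdsWithin 0 (Ioi 0)) (nhds c) := by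
  have h1 : HasDerivAt (fun s => G (x + s) - G (x - s)) (c + c) 0 := by
    have a1 : HasDerivAt (fun s => G (x + s)) c 0 := by
      have := HasDerivAt.comp_const_add x 0 (f := G) (f' := c) (by simpa using h)
      exact this
    have a2 : HasDerivAt (fun s => G (x - s)) (-c) 0 := by
      have := HasDerivAt.comp_const_sub x 0 (f := G) (f' := c) (by simpa using h)
      exact this
    have := a1.sub a2
    rw [sub_neg_eq_add] at this
    exact this
  have h2 := (hasDerivAt_iff_tendsto_slope.1 h1).mono_left
    (nhdsWithin_mono 0 (fun s (hs : s ∈ Ioi (0 : ℝ)) => (ne_of_gt hs : s ≠ 0)))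
  have h3 := h2.div_const 2
  rw [add_self_div_two] at h3
  refine h3.congr fun s => ?_
  simp only [slope_def_field, sub_zero, add_zero, sub_self]
  rw [div_div, mul_comm]

theorem tendsto_hilbertTrunc_of_hasDerivAt_logPotential {f : ℝ → ℝ} (hf : Measurable f)
    {M : ℝ} (hM : ∀ x, |f x| ≤ M) {a b : ℝ} (hsupp : ∀ x ∉ Icc a b, f x = 0)
    (hfi : Integrable f) {x c : ℝ}
    (hx : Tendsto (fun r => ⨍ y in Metric.closedBall x r, |f y - f x|)
      (nhdsWithin 0 (Ioi 0)) (nhds 0)) (hc : HasDerivAt (logPotential f) c x) :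
    Tendsto (fun s => hilbertTrunc f s x) (nhdsWithin 0 (Ioi 0)) (nhds c) := by
  have h := hc.tendsto_symmetric_slope.sub (tendsto_integral_sub_hilbertTrunc hf hfi hM hx
    measurable_logKernel logKernel_neg integrable_logKernel_sub_truncKernel)
  rw [sub_zero] at h
  refine h.congr' ?_
  filter_upwards [self_mem_nhdsWithin] with s (hs : 0 < s)
  rw [logPotential_sub_div_eq hf hM hsupp x hs, _root_.sub_sub_cancel]

theorem tendsto_integral_conjPoisson {f : ℝ → ℝ} (hf : Measurable f)
    {M : ℝ} (hM : ∀ x, |f x| ≤ M) (hfi : Integrable f) {x c : ℝ}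
    (hx : Tendsto (fun r => ⨍ y in Metric.closedBall x r, |f y - f x|)
      (nhdsWithin 0 (Ioi 0)) (nhds 0))
    (hc : Tendsto (fun s => hilbertTrunc f s x) (nhdsWithin 0 (Ioi 0)) (nhds c)) :
    Tendsto (fun s => ∫ t, f t * ((x - t) / ((x - t) ^ 2 + s ^ 2)))
      (nhdsWithin 0 (Ioi 0)) (nhds c) := by
  have h := (tendsto_integral_sub_hilbertTrunc hf hfi hM hx measurable_conjPoissonKernel
    conjPoissonKernel_neg integrable_conjPoissonKernel_sub_truncKernel).add hc
  rw [zero_add] at h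
  refine h.congr' ?_
  filter_upwards [self_mem_nhdsWithin] with s (hs : 0 < s)
  rw [integral_conjPoisson_eq f x hs, sub_add_cancel]

/-- The conjugate Poisson integral of `f` at height `y`. -/
def conjPoisson (f : ℝ → ℝ) (y x : ℝ) : ℝ := ∫ t, f t * ((x - t) / ((x - t) ^ 2 + y ^ 2))

/-- The Poisson integral of `f` at height `y`. -/
def poisson (f : ℝ → ℝ) (y x : ℝ) : ℝ := ∫ t, f t * (y / ((x - t) ^ 2 + y ^ 2))

/-- The real part of `1 / ((u + iy) (v + iy))`. -/
def pairKernel (y u v : ℝ) : ℝ := (u * v - y ^ 2) / ((u ^ 2 + y ^ 2) * (v ^ 2 + y ^ 2))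

theorem inv_sq_add_sq_eq {y : ℝ} (hy : 0 < y) (u : ℝ) :
    (u ^ 2 + y ^ 2)⁻¹ = (y ^ 2)⁻¹ * (1 + (u / y) ^ 2)⁻¹ := by
  have : 0 < u ^ 2 + y ^ 2 := by positivity
  have : 0 < 1 + (u / y) ^ 2 := by positivity
  field_simp
  ring

theorem integrable_inv_sq_add_sq {y : ℝ} (hy : 0 < y) :
    Integrable fun u : ℝ => (u ^ 2 + y ^ 2)⁻¹ := by
  simp_rw [inv_sq_add_sq_eq hy]
  exact (integrable_inv_one_add_sq.comp_div hy.ne').const_mul _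

theorem integrable_poissonKernel {y : ℝ} (hy : 0 < y) :
    Integrable fun u : ℝ => y / (u ^ 2 + y ^ 2) := by
  simp_rw [div_eq_mul_inv]
  exact (integrable_inv_sq_add_sq hy).const_mul _

theorem integral_poissonKernel {y : ℝ} (hy : 0 < y) :
    ∫ u : ℝ, y / (u ^ 2 + y ^ 2) = Real.pi := by
  simp_rw [div_eq_mul_inv, inv_sq_add_sq_eq hy]
  rw [integral_const_mul, integral_const_mul,
    Measure.integral_comp_div (fun u : ℝ => (1 + u ^ 2)⁻¹) y, integral_univ_inv_one_add_sq,
    abs_of_pos hy, smul_eq_mul]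
  field_simp

theorem abs_pairKernel_le {y : ℝ} (hy : 0 < y) (u v : ℝ) :
    |pairKernel y u v| ≤ (u ^ 2 + y ^ 2)⁻¹ + (v ^ 2 + y ^ 2)⁻¹ := by
  have hu : 0 < u ^ 2 + y ^ 2 := by positivity
  have hv : 0 < v ^ 2 + y ^ 2 := by positivity
  have e : (u ^ 2 + y ^ 2)⁻¹ + (v ^ 2 + y ^ 2)⁻¹ =
      ((v ^ 2 + y ^ 2) + (u ^ 2 + y ^ 2)) / ((u ^ 2 + y ^ 2) * (v ^ 2 + y ^ 2)) := by
    field_simp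
  rw [e, pairKernel, abs_div, abs_of_pos (mul_pos hu hv)]
  refine div_le_div_of_nonneg_right ?_ (mul_pos hu hv).le
  rw [abs_le]
  constructor <;> nlinarith [sq_nonneg (u - v), sq_nonneg (u + v), sq_nonneg y]

theorem measurable_pairKernel (y : ℝ) : Measurable fun p : ℝ × ℝ => pairKernel y p.1 p.2 := by
  unfold pairKernel
  fun_prop

theorem tendsto_log_sq_add_sq_sub {l : Filter ℝ} (hl : Tendsto (fun x : ℝ => x⁻¹) l (nhds 0))
    (hne : ∀ᶠ x in l, x ≠ 0) {y : ℝ} (hy : 0 < y) (t s : ℝ) :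
    Tendsto (fun x => Real.log ((x - t) ^ 2 + y ^ 2) - Real.log ((x - s) ^ 2 + y ^ 2)) l
      (nhds 0) := by
  have hc : Tendsto (fun z : ℝ => Real.log ((1 - t * z) ^ 2 + (y * z) ^ 2) -
      Real.log ((1 - s * z) ^ 2 + (y * z) ^ 2)) (nhds 0) (nhds 0) := by
    have : ContinuousAt (fun z : ℝ => Real.log ((1 - t * z) ^ 2 + (y * z) ^ 2) -
      Real.log ((1 - s * z) ^ 2 + (y * z) ^ 2)) 0 := by
      refine ContinuousAt.sub ?_ ?_ <;>
      exact ContinuousAt.log (by fun_prop) (by simp)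
    have h := this.tendsto
    simpa using h
  refine (hc.comp hl).congr' ?_
  filter_upwards [hne] with x hx
  have key : ∀ r : ℝ, Real.log ((x - r) ^ 2 + y ^ 2) =
      Real.log (x ^ 2) + Real.log ((1 - r * x⁻¹) ^ 2 + (y * x⁻¹) ^ 2) := by
    intro r
    have : 0 < (y * x⁻¹) ^ 2 := by positivity
    rw [← Real.log_mul (by positivity) (by positivity)]
    congr 1
    field_simp
  simp only [Function.comp_apply, key]
  ring

theorem integrable_pairKernel {y : ℝ} (hy : 0 < y) (t s : ℝ) :
    Integrable fun x => pairKernel y (x - t) (x - s) := by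
  refine (((integrable_inv_sq_add_sq hy).comp_sub_right t).add
    ((integrable_inv_sq_add_sq hy).comp_sub_right s)).mono' ?_
    (Eventually.of_forall fun x => abs_pairKernel_le hy _ _)
  exact ((measurable_pairKernel y).comp
    (by fun_prop : Measurable fun x : ℝ => (x - t, x - s))).aestronglyMeasurable

theorem integral_pairKernel_eq_zero {y : ℝ} (hy : 0 < y) {t s : ℝ} (hts : t ≠ s) :
    ∫ x, pairKernel y (x - t) (x - s) = 0 := by
  have hne : t - s ≠ 0 := sub_ne_zero.2 hts
  have hder : ∀ x, HasDerivAt (fun x => (2 * (t - s))⁻¹ * (Real.log ((x - t) ^ 2 + y ^ 2) -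
      Real.log ((x - s) ^ 2 + y ^ 2))) (pairKernel y (x - t) (x - s)) x := by
    intro x
    have hp : ∀ r : ℝ, 0 < (x - r) ^ 2 + y ^ 2 := fun r => by positivity
    have h : ∀ r : ℝ, HasDerivAt (fun x => Real.log ((x - r) ^ 2 + y ^ 2))
        (2 * (x - r) / ((x - r) ^ 2 + y ^ 2)) x := by
      intro r
      have := ((((hasDerivAt_id x).sub_const r).pow 2).add_const (y ^ 2)).log (hp r).ne'
      simpa using this
    refine (((h t).sub (h s)).const_mul (2 * (t - s))⁻¹).congr_deriv ?_
    have h1 := hp t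
    have h2 := hp s
    rw [pairKernel]
    field_simp
    ring
  have := integral_of_hasDerivAt_of_tendsto hder (integrable_pairKernel hy t s)
    ((tendsto_log_sq_add_sq_sub tendsto_inv_atBot_zero (eventually_ne_atBot 0) hy t s).const_mul _)
    ((tendsto_log_sq_add_sq_sub tendsto_inv_atTop_zero (eventually_ne_atTop 0) hy t s).const_mul _)
  rw [this, sub_self]

theorem inv_sub_sq_add_sq_le {y : ℝ} (hy : 0 < y) {R t : ℝ} (ht : |t| ≤ R) (x : ℝ) :
    ((x - t) ^ 2 + y ^ 2)⁻¹ ≤ (2 + (1 + 2 * R ^ 2) / y ^ 2) * (1 + x ^ 2)⁻¹ := by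
  have h1 : 0 < (x - t) ^ 2 + y ^ 2 := by positivity
  rw [← div_eq_mul_inv, inv_eq_one_div, div_le_div_iff₀ h1 (by positivity)]
  have h2 : t ^ 2 ≤ R ^ 2 := sq_le_sq' (abs_le.1 ht).1 (abs_le.1 ht).2
  have h3 : (1 + 2 * R ^ 2) / y ^ 2 * y ^ 2 = 1 + 2 * R ^ 2 := by field_simp
  have h4 : 0 ≤ (1 + 2 * R ^ 2) / y ^ 2 * (x - t) ^ 2 := by positivity
  nlinarith [sq_nonneg (x - 2 * t), sq_nonneg y]

theorem abs_div_sq_add_sq_le {y : ℝ} (hy : 0 < y) (u : ℝ) : |u / (u ^ 2 + y ^ 2)| ≤ y⁻¹ := by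
  have h1 : 0 < u ^ 2 + y ^ 2 := by positivity
  rw [abs_div, abs_of_pos h1, inv_eq_one_div, div_le_div_iff₀ h1 hy]
  nlinarith [sq_abs u, sq_nonneg (|u| - y), abs_nonneg u]

theorem integrable_mul_conjPoissonKernel {f : ℝ → ℝ} (hfi : Integrable f) {y : ℝ} (hy : 0 < y)
    (x : ℝ) : Integrable fun t => f t * ((x - t) / ((x - t) ^ 2 + y ^ 2)) :=
  hfi.mul_bdd (c := y⁻¹) (Measurable.aestronglyMeasurable (by fun_prop))
    (Eventually.of_forall fun t => abs_div_sq_add_sq_le hy (x - t))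

theorem integrable_mul_poissonKernel {f : ℝ → ℝ} (hfi : Integrable f) {y : ℝ} (hy : 0 < y)
    (x : ℝ) : Integrable fun t => f t * (y / ((x - t) ^ 2 + y ^ 2)) := by
  refine hfi.mul_bdd (c := y⁻¹) (Measurable.aestronglyMeasurable (by fun_prop))
    (Eventually.of_forall fun t => ?_)
  have h1 : 0 < (x - t) ^ 2 + y ^ 2 := by positivity
  rw [Real.norm_eq_abs, abs_div, abs_of_pos h1, abs_of_pos hy, inv_eq_one_div,
    div_le_div_iff₀ h1 hy]
  nlinarith [sq_nonneg (x - t)]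

theorem conjPoisson_sq_sub_poisson_sq {f : ℝ → ℝ} (hfi : Integrable f) {y : ℝ} (hy : 0 < y)
    (x : ℝ) : conjPoisson f y x ^ 2 - poisson f y x ^ 2 =
      ∫ z : ℝ × ℝ, f z.1 * f z.2 * pairKernel y (x - z.1) (x - z.2) := by
  have hQ := integrable_mul_conjPoissonKernel hfi hy x
  have hP := integrable_mul_poissonKernel hfi hy x
  rw [sq, sq, conjPoisson, poisson, ← integral_prod_mul, ← integral_prod_mul,
    ← integral_sub (hQ.mul_prod hQ) (hP.mul_prod hP), Measure.volume_eq_prod]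
  refine integral_congr_ae (Eventually.of_forall fun z => ?_)
  have h1 : 0 < (x - z.1) ^ 2 + y ^ 2 := by positivity
  have h2 : 0 < (x - z.2) ^ 2 + y ^ 2 := by positivity
  simp only [pairKernel]
  field_simp

theorem integrable_mul_pairKernel {f : ℝ → ℝ} (hf : Measurable f) (hfi : Integrable f)
    {a b : ℝ} (hsupp : ∀ x ∉ Icc a b, f x = 0) {y : ℝ} (hy : 0 < y) :
    Integrable (fun p : ℝ × (ℝ × ℝ) =>
      f p.2.1 * f p.2.2 * pairKernel y (p.1 - p.2.1) (p.1 - p.2.2))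
      (volume.prod (volume.prod volume)) := by
  set R := max |a| |b|
  set c := 2 + (1 + 2 * R ^ 2) / y ^ 2
  have hR : ∀ t ∈ Icc a b, |t| ≤ R := fun t ht => abs_le_max_abs_abs ht.1 ht.2
  have hdom := (integrable_inv_one_add_sq.const_mul (2 * c)).mul_prod (hfi.abs.mul_prod hfi.abs)
  refine hdom.mono' ?_ (Eventually.of_forall fun p => ?_)
  · refine Measurable.aestronglyMeasurable ?_
    unfold pairKernel
    fun_prop
  · rw [Real.norm_eq_abs, abs_mul, abs_mul, mul_comm]
    by_cases h1 : p.2.1 ∈ Icc a b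
    · by_cases h2 : p.2.2 ∈ Icc a b
      · refine mul_le_mul_of_nonneg_right ?_ (by positivity)
        refine (abs_pairKernel_le hy _ _).trans ?_
        have e1 := inv_sub_sq_add_sq_le hy (hR _ h1) p.1
        have e2 := inv_sub_sq_add_sq_le hy (hR _ h2) p.1
        linarith
      · simp [hsupp _ h2]
    · simp [hsupp _ h1]

theorem integral_mul_pairKernel_eq_zero {f : ℝ → ℝ} (hf : Measurable f) (hfi : Integrable f)
    {a b : ℝ} (hsupp : ∀ x ∉ Icc a b, f x = 0) {y : ℝ} (hy : 0 < y) :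
    ∫ x, ∫ z : ℝ × ℝ, f z.1 * f z.2 * pairKernel y (x - z.1) (x - z.2) = 0 := by
  rw [integral_integral_swap (integrable_mul_pairKernel hf hfi hsupp hy)]
  refine integral_eq_zero_of_ae ?_
  have hdiag : ∀ᵐ z : ℝ × ℝ, z.1 ≠ z.2 := by
    rw [Measure.volume_eq_prod]
    refine (Measure.ae_prod_iff_ae_ae (p := fun z : ℝ × ℝ => z.1 ≠ z.2)
      (measurableSet_eq_fun measurable_fst measurable_snd).compl).2 ?_
    exact Eventually.of_forall fun t => by simp [ae_iff]
  filter_upwards [hdiag] with z hz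
  rw [integral_const_mul, integral_pairKernel_eq_zero hy hz, mul_zero]
  rfl

theorem integrable_poisson_sq_and_integral_le {f : ℝ → ℝ} (hfi : Integrable f)
    {M : ℝ} (hM : ∀ x, |f x| ≤ M) {y : ℝ} (hy : 0 < y) :
    Integrable (fun x => poisson f y x ^ 2) ∧
      ∫ x, poisson f y x ^ 2 ≤ M * Real.pi ^ 2 * ∫ t, |f t| := by
  have hM0 : 0 ≤ M := (abs_nonneg _).trans (hM 0)
  have hk := integrable_poissonKernel hy
  have hker : ∀ u : ℝ, 0 ≤ y / (u ^ 2 + y ^ 2) := fun u => by positivity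
  have hc := hfi.integrable_convolution (ContinuousLinearMap.mul ℝ ℝ) hk
  have hca := hfi.abs.integrable_convolution (ContinuousLinearMap.mul ℝ ℝ) hk
  have hmeas : AEStronglyMeasurable (poisson f y) volume := hc.aestronglyMeasurable
  have habs : Integrable (poisson (fun t => |f t|) y) := hca
  have h_integral : ∫ x, poisson (fun t => |f t|) y x = (∫ t, |f t|) * Real.pi := by
    rw [← integral_poissonKernel hy]
    exact integral_convolution (ContinuousLinearMap.mul ℝ ℝ) hfi.abs hk
  have hkx : ∀ x, Integrable fun t => y / ((x - t) ^ 2 + y ^ 2) := fun x => hk.comp_sub_left x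
  have b1 : ∀ x, |poisson f y x| ≤ poisson (fun t => |f t|) y x := by
    intro x
    refine (norm_integral_le_integral_norm (μ := volume)
      (fun t => f t * (y / ((x - t) ^ 2 + y ^ 2)))).trans_eq ?_
    refine integral_congr_ae (Eventually.of_forall fun t => ?_)
    simp only [Real.norm_eq_abs, abs_mul, abs_of_nonneg (hker (x - t))]
  have b2 : ∀ x, poisson (fun t => |f t|) y x ≤ M * Real.pi := by
    intro x
    have e : ∫ t, M * (y / ((x - t) ^ 2 + y ^ 2)) = M * Real.pi := by
      rw [integral_const_mul, integral_sub_left_eq_self (fun u => y / (u ^ 2 + y ^ 2)) volume x,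
        integral_poissonKernel hy]
    rw [← e]
    exact integral_mono (integrable_mul_poissonKernel hfi.abs hy x) ((hkx x).const_mul M)
      fun t => mul_le_mul_of_nonneg_right (hM t) (hker _)
  have b3 : ∀ x, poisson f y x ^ 2 ≤ M * Real.pi * poisson (fun t => |f t|) y x := by
    intro x
    rw [← sq_abs, sq]
    exact mul_le_mul ((b1 x).trans (b2 x)) (b1 x) (abs_nonneg _) (by positivity)
  have hi : Integrable fun x => poisson f y x ^ 2 := by
    refine (habs.const_mul (M * Real.pi)).mono' (hmeas.pow 2) (Eventually.of_forall fun x => ?_)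
    rw [Real.norm_eq_abs, abs_of_nonneg (sq_nonneg _)]
    exact b3 x
  refine ⟨hi, (integral_mono hi (habs.const_mul _) b3).trans_eq ?_⟩
  rw [integral_const_mul, h_integral]
  ring

theorem integrable_conjPoisson_sq_and_integral_le {f : ℝ → ℝ} (hf : Measurable f)
    (hfi : Integrable f) {M : ℝ} (hM : ∀ x, |f x| ≤ M) {a b : ℝ}
    (hsupp : ∀ x ∉ Icc a b, f x = 0) {y : ℝ} (hy : 0 < y) :
    Integrable (fun x => conjPoisson f y x ^ 2) ∧
      ∫ x, conjPoisson f y x ^ 2 ≤ M * Real.pi ^ 2 * ∫ t, |f t| := by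
  obtain ⟨hPi, hPle⟩ := integrable_poisson_sq_and_integral_le hfi hM hy
  have hdi : Integrable fun x =>
      ∫ z : ℝ × ℝ, f z.1 * f z.2 * pairKernel y (x - z.1) (x - z.2) :=
    (integrable_mul_pairKernel hf hfi hsupp hy).integral_prod_left
  have e : (fun x => conjPoisson f y x ^ 2) = fun x =>
      (∫ z : ℝ × ℝ, f z.1 * f z.2 * pairKernel y (x - z.1) (x - z.2)) + poisson f y x ^ 2 := by
    ext x
    rw [← conjPoisson_sq_sub_poisson_sq hfi hy x, sub_add_cancel]
  rw [e]
  refine ⟨hdi.add hPi, ?_⟩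
  rw [integral_add hdi hPi]
  have := integral_mul_pairKernel_eq_zero hf hfi hsupp hy
  rw [this, zero_add]
  exact hPle

/-- The logarithmic potential of `f` at height `y`. -/
def smoothPotential (f : ℝ → ℝ) (y x : ℝ) : ℝ := ∫ t, f t * (Real.log ((x - t) ^ 2 + y ^ 2) / 2)

theorem continuous_log_sq_add_sq {y : ℝ} (hy : 0 < y) (x : ℝ) :
    Continuous fun t : ℝ => Real.log ((x - t) ^ 2 + y ^ 2) / 2 := by
  refine Continuous.div_const (Continuous.log (by fun_prop) fun t => ?_) 2
  positivity

theorem integrable_mul_log_sq_add_sq {f : ℝ → ℝ} (hf : Measurable f) {M : ℝ}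
    (hM : ∀ x, |f x| ≤ M) {a b : ℝ} (hsupp : ∀ x ∉ Icc a b, f x = 0) {y : ℝ} (hy : 0 < y)
    (x : ℝ) : Integrable fun t => f t * (Real.log ((x - t) ^ 2 + y ^ 2) / 2) :=
  integrable_mul_of_eq_zero_off_Icc hf hM hsupp (continuous_log_sq_add_sq hy x).integrableOn_Icc

theorem tendsto_smoothPotential {f : ℝ → ℝ} (hf : Measurable f) {M : ℝ}
    (hM : ∀ x, |f x| ≤ M) {a b : ℝ} (hsupp : ∀ x ∉ Icc a b, f x = 0) (x : ℝ) {y : ℕ → ℝ}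
    (hy : ∀ n, 0 < y n) (hy1 : ∀ n, y n ≤ 1) (hlim : Tendsto y atTop (nhds 0)) :
    Tendsto (fun n => smoothPotential f (y n) x) atTop (nhds (logPotential f x)) := by
  have hne : ∀ᵐ t : ℝ, t ≠ x := by simp [ae_iff]
  have hlog : ∀ u : ℝ, Real.log (u ^ 2) / 2 = Real.log u := fun u => by
    rw [Real.log_pow]; push_cast; ring
  refine tendsto_integral_of_dominated_convergence
    (fun t => |f t * Real.log (x - t)| + |f t * (Real.log ((x - t) ^ 2 + 1 ^ 2) / 2)|)
    (fun n => (integrable_mul_log_sq_add_sq hf hM hsupp (hy n) x).aestronglyMeasurable)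
    ((integrable_mul_log_sub hf hM hsupp x).abs.add
      (integrable_mul_log_sq_add_sq hf hM hsupp one_pos x).abs) (fun n => ?_) ?_
  · filter_upwards [hne] with t ht
    have h0 : x - t ≠ 0 := sub_ne_zero.2 ht.symm
    have h2 : 0 < (x - t) ^ 2 := by positivity
    have l1 : Real.log (x - t) ≤ Real.log ((x - t) ^ 2 + y n ^ 2) / 2 := by
      rw [← hlog]
      have := Real.log_le_log h2 (le_add_of_nonneg_right (sq_nonneg (y n)))
      linarith
    have l2 : Real.log ((x - t) ^ 2 + y n ^ 2) / 2 ≤ Real.log ((x - t) ^ 2 + 1 ^ 2) / 2 := by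
      have hs : y n ^ 2 ≤ 1 ^ 2 := pow_le_pow_left₀ (hy n).le (hy1 n) 2
      exact div_le_div_of_nonneg_right
        (Real.log_le_log (by positivity) (add_le_add_right hs _)) zero_le_two
    rw [Real.norm_eq_abs, abs_mul, abs_mul, abs_mul, ← mul_add]
    refine mul_le_mul_of_nonneg_left ?_ (abs_nonneg _)
    rw [abs_le]
    constructor
    · linarith [neg_abs_le (Real.log (x - t)), abs_nonneg (Real.log ((x - t) ^ 2 + 1 ^ 2) / 2)]
    · linarith [le_abs_self (Real.log ((x - t) ^ 2 + 1 ^ 2) / 2), abs_nonneg (Real.log (x - t))]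
  · filter_upwards [hne] with t ht
    have h0 : x - t ≠ 0 := sub_ne_zero.2 ht.symm
    refine Tendsto.const_mul _ ?_
    rw [← hlog (x - t)]
    have hc : ContinuousAt (fun s : ℝ => Real.log ((x - t) ^ 2 + s ^ 2) / 2) 0 := by
      refine ContinuousAt.div_const (ContinuousAt.log (by fun_prop) ?_) 2
      simpa using h0
    have := hc.tendsto.comp hlim
    simpa [Function.comp_def] using this

theorem hasDerivAt_smoothPotential {f : ℝ → ℝ} (hf : Measurable f) {M : ℝ}
    (hM : ∀ x, |f x| ≤ M) (hfi : Integrable f) {a b : ℝ} (hsupp : ∀ x ∉ Icc a b, f x = 0)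
    {y : ℝ} (hy : 0 < y) (x : ℝ) :
    HasDerivAt (smoothPotential f y) (conjPoisson f y x) x := by
  refine (hasDerivAt_integral_of_dominated_loc_of_deriv_le (bound := fun t => |f t| * y⁻¹)
    univ_mem (Eventually.of_forall fun z =>
      (integrable_mul_log_sq_add_sq hf hM hsupp hy z).aestronglyMeasurable)
    (integrable_mul_log_sq_add_sq hf hM hsupp hy x)
    (integrable_mul_conjPoissonKernel hfi hy x).aestronglyMeasurable
    (F' := fun x t => f t * ((x - t) / ((x - t) ^ 2 + y ^ 2)))
    (Eventually.of_forall fun t z _ => ?_) (hfi.abs.mul_const _)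
    (Eventually.of_forall fun t z _ => ?_)).2
  · rw [Real.norm_eq_abs, abs_mul]
    exact mul_le_mul_of_nonneg_left (abs_div_sq_add_sq_le hy _) (abs_nonneg _)
  · have hp : 0 < (z - t) ^ 2 + y ^ 2 := by positivity
    have h : HasDerivAt (fun x => Real.log ((x - t) ^ 2 + y ^ 2))
        (2 * (z - t) / ((z - t) ^ 2 + y ^ 2)) z := by
      have := ((((hasDerivAt_id z).sub_const t).pow 2).add_const (y ^ 2)).log hp.ne'
      simpa using this
    refine ((h.div_const 2).const_mul (f t)).congr_deriv ?_
    field_simp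

theorem continuous_conjPoisson {f : ℝ → ℝ} (hfi : Integrable f) {y : ℝ} (hy : 0 < y) :
    Continuous (conjPoisson f y) := by
  refine continuous_of_dominated (bound := fun t => |f t| * y⁻¹)
    (fun x => (integrable_mul_conjPoissonKernel hfi hy x).aestronglyMeasurable)
    (fun x => Eventually.of_forall fun t => ?_) (hfi.abs.mul_const _)
    (Eventually.of_forall fun t => ?_)
  · rw [Real.norm_eq_abs, abs_mul]
    exact mul_le_mul_of_nonneg_left (abs_div_sq_add_sq_le hy _) (abs_nonneg _)
  · refine continuous_const.mul (Continuous.div (by fun_prop) (by fun_prop) fun x => ?_)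
    positivity

theorem eVariationOn_le_integral_abs_deriv {G Q : ℝ → ℝ} (hQ : Continuous Q)
    (hG : ∀ x, HasDerivAt G (Q x) x) (p q : ℝ) :
    eVariationOn G (univ ∩ Icc p q) ≤ ENNReal.ofReal (∫ x in p..q, |Q x|) := by
  set V : ℝ → ℝ := fun x => ∫ z in p..x, |Q z|
  have hii : ∀ u v, IntervalIntegrable (fun z => |Q z|) volume u v :=
    fun u v => hQ.abs.intervalIntegrable u v
  have hV : ∀ u v, V v - V u = ∫ z in u..v, |Q z| := fun u v =>
    intervalIntegral.integral_interval_sub_left (hii _ _) (hii _ _)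
  have hmono : MonotoneOn V univ := by
    intro u _ v _ huv
    have : 0 ≤ V v - V u := by
      rw [hV]
      exact intervalIntegral.integral_nonneg huv fun z _ => abs_nonneg _
    linarith
  have hle : ∀ u v, u ≤ v → edist (G v) (G u) ≤ edist (V v) (V u) := by
    intro u v huv
    rw [edist_dist, edist_dist, Real.dist_eq, Real.dist_eq]
    refine ENNReal.ofReal_le_ofReal ?_
    rw [hV, ← intervalIntegral.integral_eq_sub_of_hasDerivAt (fun z _ => hG z)
      (hQ.intervalIntegrable u v)]
    exact (intervalIntegral.abs_integral_le_integral_abs huv).trans (le_abs_self _)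
  have hVq : V q - V p = ∫ x in p..q, |Q x| := hV p q
  rw [← hVq]
  refine le_trans ?_ (hmono.eVariationOn_eq (mem_univ p) (mem_univ q)).le
  refine iSup_le ?_
  rintro ⟨n, u, hu, hus⟩
  refine le_trans (Finset.sum_le_sum fun i _ => ?_) (eVariationOn.sum_le (n := n) hu hus)
  exact hle _ _ (hu (Nat.le_succ i))

theorem eVariationOn_smoothPotential_le {f : ℝ → ℝ} (hf : Measurable f) {M : ℝ}
    (hM : ∀ x, |f x| ≤ M) (hfi : Integrable f) {a b : ℝ} (hsupp : ∀ x ∉ Icc a b, f x = 0)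
    {y : ℝ} (hy : 0 < y) {p q : ℝ} (hpq : p ≤ q) :
    eVariationOn (smoothPotential f y) (univ ∩ Icc p q) ≤
      ENNReal.ofReal (q - p + M * Real.pi ^ 2 * ∫ t, |f t|) := by
  have hc := continuous_conjPoisson hfi hy
  have hc2 : Continuous fun x => conjPoisson f y x ^ 2 := hc.pow 2
  obtain ⟨hi, hb⟩ := integrable_conjPoisson_sq_and_integral_le hf hfi hM hsupp hy
  refine (eVariationOn_le_integral_abs_deriv hc
    (hasDerivAt_smoothPotential hf hM hfi hsupp hy) p q).trans (ENNReal.ofReal_le_ofReal ?_)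
  have h1 : ∫ x in p..q, |conjPoisson f y x| ≤ ∫ x in p..q, (1 + conjPoisson f y x ^ 2) :=
    intervalIntegral.integral_mono_on hpq (hc.abs.intervalIntegrable _ _)
      ((continuous_const.add hc2).intervalIntegrable _ _) fun x _ => by
        nlinarith [sq_abs (conjPoisson f y x), sq_nonneg (|conjPoisson f y x| - 1)]
  rw [intervalIntegral.integral_add (by simp) (hc2.intervalIntegrable _ _),
    intervalIntegral.integral_const, smul_eq_mul, mul_one] at h1
  have h2 : ∫ x in p..q, conjPoisson f y x ^ 2 ≤ ∫ x, conjPoisson f y x ^ 2 := by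
    rw [intervalIntegral.integral_of_le hpq]
    exact setIntegral_le_integral hi (Eventually.of_forall fun x => sq_nonneg _)
  linarith

theorem ae_differentiableAt_logPotential {f : ℝ → ℝ} (hf : Measurable f) {M : ℝ}
    (hM : ∀ x, |f x| ≤ M) (hfi : Integrable f) {a b : ℝ} (hsupp : ∀ x ∉ Icc a b, f x = 0) :
    ∀ᵐ x, DifferentiableAt ℝ (logPotential f) x := by
  refine LocallyBoundedVariationOn.ae_differentiableAt fun p q _ _ => ?_
  rcases le_or_gt p q with hpq | hpq
  · refine ne_top_of_le_ne_top
      (ENNReal.ofReal_ne_top (r := q - p + M * Real.pi ^ 2 * ∫ t, |f t|)) ?_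
    by_contra! hlt
    have hlim : ∀ x ∈ univ ∩ Icc p q,
        Tendsto (fun n : ℕ => smoothPotential f (1 / ((n : ℝ) + 1)) x) atTop
        (nhds (logPotential f x)) := fun x _ =>
      tendsto_smoothPotential hf hM hsupp x (fun n => by positivity)
        (fun n => by
          rw [div_le_one (by positivity)]
          linarith [(Nat.cast_nonneg n : (0 : ℝ) ≤ n)])
        tendsto_one_div_add_atTop_nhds_zero_nat
    obtain ⟨n, hn⟩ := (eVariationOn.lowerSemicontinuous_aux hlim hlt).exists
    exact hn.not_ge (eVariationOn_smoothPotential_le hf hM hfi hsupp (by positivity) hpq)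
  · simp [Icc_eq_empty (not_le.2 hpq)]

theorem ae_tendsto_deriv_logPotential {f : ℝ → ℝ} (hf : Measurable f) {M : ℝ}
    (hM : ∀ x, |f x| ≤ M) (hfi : Integrable f) {a b : ℝ} (hsupp : ∀ x ∉ Icc a b, f x = 0) :
    ∀ᵐ x, Tendsto (fun s => hilbertTrunc f s x) (nhdsWithin 0 (Ioi 0))
        (nhds (deriv (logPotential f) x)) ∧
      Tendsto (fun s => conjPoisson f s x) (nhdsWithin 0 (Ioi 0))
        (nhds (deriv (logPotential f) x)) := by
  filter_upwards [ae_tendsto_average_abs_sub hfi.locallyIntegrable,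
    ae_differentiableAt_logPotential hf hM hfi hsupp] with x hx hd
  have h := tendsto_hilbertTrunc_of_hasDerivAt_logPotential hf hM hsupp hfi hx hd.hasDerivAt
  exact ⟨h, tendsto_integral_conjPoisson hf hM hfi hx h⟩

theorem integrable_deriv_logPotential_sq_and_integral_le {f : ℝ → ℝ} (hf : Measurable f) {M : ℝ}
    (hM : ∀ x, |f x| ≤ M) (hfi : Integrable f) {a b : ℝ} (hsupp : ∀ x ∉ Icc a b, f x = 0) :
    Integrable (fun x => deriv (logPotential f) x ^ 2) ∧
      ∫ x, deriv (logPotential f) x ^ 2 ≤ M * Real.pi ^ 2 * ∫ t, |f t| := by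
  set B := M * Real.pi ^ 2 * ∫ t, |f t|
  have hB : 0 ≤ B := by
    have := (abs_nonneg _).trans (hM 0)
    have : 0 ≤ ∫ t, |f t| := integral_nonneg fun t => abs_nonneg _
    positivity
  have hmeas : Measurable fun x => deriv (logPotential f) x ^ 2 := (measurable_deriv _).pow_const 2
  have hy : ∀ n : ℕ, 0 < 1 / ((n : ℝ) + 1) := fun n => by positivity
  have hylim : Tendsto (fun n : ℕ => 1 / ((n : ℝ) + 1)) atTop (nhdsWithin 0 (Ioi 0)) :=
    tendsto_nhdsWithin_iff.2 ⟨tendsto_one_div_add_atTop_nhds_zero_nat, Eventually.of_forall hy⟩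
  have hcm : ∀ n : ℕ, Measurable fun x =>
      ENNReal.ofReal (conjPoisson f (1 / ((n : ℝ) + 1)) x ^ 2) := fun n =>
    ((continuous_conjPoisson hfi (hy n)).measurable.pow_const 2).ennreal_ofReal
  have hfatou : ∫⁻ x, ENNReal.ofReal (deriv (logPotential f) x ^ 2) ≤ ENNReal.ofReal B := by
    calc ∫⁻ x, ENNReal.ofReal (deriv (logPotential f) x ^ 2)
        = ∫⁻ x, liminf (fun n : ℕ =>
            ENNReal.ofReal (conjPoisson f (1 / ((n : ℝ) + 1)) x ^ 2)) atTop := by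
          refine lintegral_congr_ae ?_
          filter_upwards [ae_tendsto_deriv_logPotential hf hM hfi hsupp] with x hx
          exact ((ENNReal.tendsto_ofReal ((hx.2.comp hylim).pow 2)).liminf_eq).symm
      _ ≤ liminf (fun n : ℕ => ∫⁻ x,
            ENNReal.ofReal (conjPoisson f (1 / ((n : ℝ) + 1)) x ^ 2)) atTop :=
          lintegral_liminf_le hcm
      _ ≤ ENNReal.ofReal B := by
          refine liminf_le_of_frequently_le' (Frequently.of_forall fun n => ?_)
          obtain ⟨hi, hb⟩ := integrable_conjPoisson_sq_and_integral_le hf hfi hM hsupp (hy n)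
          rw [← ofReal_integral_eq_lintegral_ofReal hi (Eventually.of_forall fun x => sq_nonneg _)]
          exact ENNReal.ofReal_le_ofReal hb
  have hnn : 0 ≤ᵐ[volume] fun x => deriv (logPotential f) x ^ 2 :=
    Eventually.of_forall fun x => sq_nonneg _
  refine ⟨(lintegral_ofReal_ne_top_iff_integrable hmeas.aestronglyMeasurable hnn).1
    (ne_top_of_le_ne_top ENNReal.ofReal_ne_top hfatou), ?_⟩
  rw [integral_eq_lintegral_of_nonneg_ae hnn hmeas.aestronglyMeasurable]
  exact ENNReal.toReal_le_of_le_ofReal hB hfatou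

theorem abs_slope_le_of_lipschitzWith {A : ℝ → ℝ} {L : ℝ} (hL : 0 ≤ L)
    (hA : LipschitzWith L.toNNReal A) (x c : ℝ) : |(A x - A c) / (x - c)| ≤ L := by
  have h := hA.dist_le_mul x c
  rw [Real.dist_eq, Real.dist_eq, Real.coe_toNNReal _ hL] at h
  rw [abs_div]
  exact div_le_of_le_mul₀ (abs_nonneg _) hL h

theorem setIntegral_boundary_add_sq_le {A : ℝ → ℝ} {L : ℝ} (hL : 0 ≤ L)
    (hA : LipschitzWith L.toNNReal A) {h : ℝ → ℝ} {a b : ℝ} (hab : a < b)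
    (hi : Integrable fun x => h x ^ 2)
    (hb : ∫ x, h x ^ 2 ≤ Real.pi ^ 2 * L ^ 2 * (b - a)) :
    ∫ x in Icc a b, ((A x - A b) / (x - b) - (A x - A a) / (x - a) + h x) ^ 2 ≤
      (6 + 3 * Real.pi ^ 2) * L ^ 2 * (b - a) := by
  have hpt : ∀ x, ((A x - A b) / (x - b) - (A x - A a) / (x - a) + h x) ^ 2 ≤
      6 * L ^ 2 + 3 * h x ^ 2 := by
    intro x
    set u := (A x - A b) / (x - b)
    set v := (A x - A a) / (x - a)
    have h1 : u ^ 2 ≤ L ^ 2 := sq_le_sq' (abs_le.1 (abs_slope_le_of_lipschitzWith hL hA x b)).1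
      (abs_le.1 (abs_slope_le_of_lipschitzWith hL hA x b)).2
    have h2 : v ^ 2 ≤ L ^ 2 := sq_le_sq' (abs_le.1 (abs_slope_le_of_lipschitzWith hL hA x a)).1
      (abs_le.1 (abs_slope_le_of_lipschitzWith hL hA x a)).2
    nlinarith [sq_nonneg (u + v), sq_nonneg (u - h x), sq_nonneg (v + h x)]
  have hci : Integrable (fun _ : ℝ => 6 * L ^ 2) (volume.restrict (Icc a b)) :=
    integrable_const _
  have hhi : Integrable (fun x => 3 * h x ^ 2) (volume.restrict (Icc a b)) :=
    (hi.const_mul 3).integrableOn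
  calc ∫ x in Icc a b, ((A x - A b) / (x - b) - (A x - A a) / (x - a) + h x) ^ 2
      ≤ ∫ x in Icc a b, (6 * L ^ 2 + 3 * h x ^ 2) :=
        integral_mono_of_nonneg (Eventually.of_forall fun x => sq_nonneg _) (hci.add hhi)
          (Eventually.of_forall hpt)
    _ = 6 * L ^ 2 * (b - a) + 3 * ∫ x in Icc a b, h x ^ 2 := by
        rw [integral_add hci hhi, setIntegral_const, integral_const_mul, Real.volume_real_Icc_of_le
          hab.le, smul_eq_mul, mul_comm (b - a)]
    _ ≤ (6 + 3 * Real.pi ^ 2) * L ^ 2 * (b - a) := by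
        have := setIntegral_le_integral (s := Icc a b) hi
          (Eventually.of_forall fun x => sq_nonneg (h x))
        linarith

/-- **Testing bound and explicit identity for the Calderón commutator on an interval.**
For `A : ℝ → ℝ` Lipschitz with constant `L` and `I = [a,b]`: the principal value defining
`C_A(χ_I)(x)` exists for a.e. `x`, with `∫_I |C_A χ_I|² ≤ C L² |I|` for an absolute
constant `C`; moreover, for every `x ∉ {a,b}` (at which `A` is differentiable) one has
`C_A(χ_{[a,b]})(x) = (A(x)−A(b))/(x−b) − (A(x)−A(a))/(x−a) + H(A′χ_{(a,b)})(x)`. -/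
theorem calderon_commutator_on_interval :
    ∃ C : ℝ, 0 < C ∧
      ∀ (A : ℝ → ℝ) (L : ℝ), 0 ≤ L → LipschitzWith L.toNNReal A →
        ∀ A' : ℝ → ℝ, (∀ᵐ x : ℝ, HasDerivAt A (A' x) x) →
          ∀ a b : ℝ, a < b →
            (∃ g : ℝ → ℝ,
              (∀ᵐ x : ℝ,
                Tendsto (fun ε => commTrunc A ((Set.Icc a b).indicator fun _ => (1:ℝ)) ε x)
                  (nhdsWithin 0 (Set.Ioi 0)) (nhds (g x))) ∧
              (∫ x in Set.Icc a b, g x ^ 2) ≤ C * L ^ 2 * (b - a)) ∧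
            ∀ x : ℝ, x ≠ a → x ≠ b → HasDerivAt A (A' x) x →
              ∀ hx : ℝ,
                Tendsto (fun ε => hilbertTrunc ((Set.Ioo a b).indicator A') ε x)
                  (nhdsWithin 0 (Set.Ioi 0)) (nhds hx) →
                Tendsto (fun ε => commTrunc A ((Set.Icc a b).indicator fun _ => (1:ℝ)) ε x)
                  (nhdsWithin 0 (Set.Ioi 0))
                  (nhds ((A x - A b) / (x - b) - (A x - A a) / (x - a) + hx)) := by
  refine ⟨6 + 3 * Real.pi ^ 2, by positivity, fun A L hL hA A' hA' a b hab => ?_⟩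
  set f := (Ioo a b).indicator (deriv A)
  have hff : (Ioo a b).indicator A' =ᵐ[volume] f := by
    filter_upwards [hA'] with x hx
    by_cases h : x ∈ Ioo a b <;> simp [f, h, hx.deriv]
  have hf : Measurable f := (measurable_deriv A).indicator measurableSet_Ioo
  have hderiv : ∀ x, |deriv A x| ≤ L := fun x => by
    simpa [Real.coe_toNNReal _ hL] using norm_deriv_le_of_lipschitz (x₀ := x) hA
  have hfle : ∀ x, |f x| ≤ (Ioo a b).indicator (fun _ => L) x := fun x => by
    by_cases hx : x ∈ Ioo a b
    · simpa [f, hx] using hderiv x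
    · simp [f, hx]
  have hM : ∀ x, |f x| ≤ L := fun x =>
    (hfle x).trans (indicator_le_self' (fun _ _ => hL) x)
  have hsupp : ∀ x ∉ Icc a b, f x = 0 := fun x hx =>
    indicator_of_notMem (fun h => hx (Ioo_subset_Icc_self h)) _
  have hdom : Integrable ((Ioo a b).indicator fun _ => L) :=
    (integrable_indicator_iff measurableSet_Ioo).2 (integrableOn_const (by simp))
  have hfi : Integrable f := hdom.mono' hf.aestronglyMeasurable (Eventually.of_forall hfle)
  have hf1 : ∫ t, |f t| ≤ L * (b - a) := by
    refine (integral_mono hfi.abs hdom hfle).trans_eq ?_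
    rw [integral_indicator measurableSet_Ioo, setIntegral_const, Real.volume_real_Ioo_of_le hab.le,
      smul_eq_mul, mul_comm]
  obtain ⟨hi, hb⟩ := integrable_deriv_logPotential_sq_and_integral_le hf hM hfi hsupp
  refine ⟨⟨fun x => (A x - A b) / (x - b) - (A x - A a) / (x - a) + deriv (logPotential f) x,
    ?_, setIntegral_boundary_add_sq_le hL hA hab hi (hb.trans ?_)⟩, ?_⟩
  · have hne : ∀ c : ℝ, ∀ᵐ x : ℝ, x ≠ c := fun c => by simp [ae_iff]
    filter_upwards [hA', hne a, hne b, ae_tendsto_deriv_logPotential hf hM hfi hsupp]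
      with x hx hxa hxb hlim
    exact tendsto_commTrunc_indicator_Icc hA hab hxa hxb hx hlim.1
  · calc L * Real.pi ^ 2 * ∫ t, |f t| ≤ L * Real.pi ^ 2 * (L * (b - a)) := by gcongr
      _ = Real.pi ^ 2 * L ^ 2 * (b - a) := by ring
  · intro x hxa hxb hx l hl
    simp_rw [hilbertTrunc_congr_ae hff] at hl
    exact tendsto_commTrunc_indicator_Icc hA hab hxa hxb hx hl
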